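/- Let p ≥ 5 be a prime. There does not exist a regular (8p^3, 4p^2+2p−2, 2p−2, 2p+2)-partial difference set in any Abelian group of order 8p^3. -/

import Mathlib

variable {G : Type*} [CommGroup G] [DecidableEq G] [Fintype G]

/-- The number of representations of `g` as `d₁ * d₂⁻¹` with `d₁, d₂ ∈ D`, `d₁ ≠ d₂`. -/
def pdsReps (D : Finset G) (g : G) : ℕ :=
  ((D ×ˢ D).filter (fun x => x.1 ≠ x.2 ∧ x.1 * x.2⁻¹ = g)).card

/-- `D` is a `(v,k,λ,μ)`-partial difference set in `G`. -/
def IsPDS (D : Finset G) (v k l m : ℕ) : Prop :=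
  Fintype.card G = v ∧ D.card = k ∧
  (∀ g : G, g ≠ 1 → g ∈ D → pdsReps D g = l) ∧
  (∀ g : G, g ≠ 1 → g ∉ D → pdsReps D g = m)

/-- `D` is regular: closed under inverses and not containing the identity. -/
def IsRegularPDS (D : Finset G) : Prop :=
  (∀ d ∈ D, d⁻¹ ∈ D) ∧ (1 : G) ∉ D

/-- A regular PDS is trivial if `D ∪ {e}` or `G \ D` is a subgroup. -/
def IsTrivialPDS (D : Finset G) : Prop :=
  (∃ H : Subgroup G, (H : Set G) = ↑D ∪ {1}) ∨
  (∃ H : Subgroup G, (H : Set G) = (↑D : Set G)ᶜ)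

set_option linter.unusedSectionVars false

open MonoidAlgebra in
/-- The element `∑ d ∈ D, d` of the group algebra. -/
noncomputable def groupAlgebraSum (R : Type*) [CommRing R] (D : Finset G) : MonoidAlgebra R G :=
  ∑ d ∈ D, of R G d

open MonoidAlgebra in
lemma coeff_sum_of {R ι : Type*} [CommRing R] (s : Finset ι) (f : ι → G) (g : G) :
    (∑ i ∈ s, of R G (f i)).coeff g = ((s.filter fun i => f i = g).card : R) := by
  simp [Finsupp.single_apply]

lemma coeff_groupAlgebraSum {R : Type*} [CommRing R] (D : Finset G) (g : G) :
    (groupAlgebraSum R D).coeff g = if g ∈ D then 1 else 0 := by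
  rw [groupAlgebraSum, coeff_sum_of D (fun d => d) g, Finset.filter_eq']
  split_ifs <;> simp

lemma coeff_natCast_monoidAlgebra {R : Type*} [CommRing R] (n : ℕ) (g : G) :
    (n : MonoidAlgebra R G).coeff g = if g = 1 then (n : R) else 0 := by
  rw [MonoidAlgebra.natCast_def]
  simp [Finsupp.single_apply, eq_comm]

lemma card_filter_mul_inv_eq_pdsReps (D : Finset G) {g : G} (hg : g ≠ 1) :
    ((D ×ˢ D).filter fun x => x.1 * x.2⁻¹ = g).card = pdsReps D g := by
  unfold pdsReps
  congr 1
  apply Finset.filter_congr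
  intro x _
  refine ⟨fun h => ⟨fun hx => hg ?_, h⟩, fun h => h.2⟩
  rw [← h, hx, mul_inv_cancel]

lemma card_filter_mul_inv_eq_one (D : Finset G) :
    ((D ×ˢ D).filter fun x => x.1 * x.2⁻¹ = 1).card = D.card := by
  have h : ((D ×ˢ D).filter fun x => x.1 * x.2⁻¹ = 1) = D.diag := by
    ext x
    simp only [Finset.mem_filter, Finset.mem_product, mul_inv_eq_one, Finset.mem_diag]
    grind
  rw [h, Finset.diag_card]

open MonoidAlgebra in
lemma groupAlgebraSum_mul_self_eq_sum {R : Type*} [CommRing R] {D : Finset G}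
    (hD : ∀ d ∈ D, d⁻¹ ∈ D) :
    groupAlgebraSum R D * groupAlgebraSum R D = ∑ x ∈ D ×ˢ D, of R G (x.1 * x.2⁻¹) := by
  have h : groupAlgebraSum R D = ∑ d ∈ D, of R G d⁻¹ :=
    Finset.sum_nbij' (·⁻¹) (·⁻¹) hD hD (by simp) (by simp) (by simp)
  conv_lhs =>
    arg 2
    rw [h]
  rw [groupAlgebraSum, Finset.sum_mul_sum, Finset.sum_product]
  simp only [map_mul]

lemma IsPDS.groupAlgebraSum_mul_self {R : Type*} [CommRing R] {D : Finset G} {v k l m : ℕ}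
    (h : IsPDS D v k l m) (hreg : IsRegularPDS D) :
    groupAlgebraSum R D * groupAlgebraSum R D + (m : MonoidAlgebra R G) + m • groupAlgebraSum R D =
      (k : MonoidAlgebra R G) + l • groupAlgebraSum R D +
        m • groupAlgebraSum R Finset.univ := by
  obtain ⟨-, hk, hl, hm⟩ := h
  rw [groupAlgebraSum_mul_self_eq_sum hreg.1]
  ext g
  simp only [MonoidAlgebra.coeff_add, Finsupp.add_apply, MonoidAlgebra.coeff_smul,
    Finsupp.smul_apply, coeff_sum_of, coeff_groupAlgebraSum, coeff_natCast_monoidAlgebra]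
  by_cases hg : g = 1
  · subst hg
    simp [card_filter_mul_inv_eq_one, hk, hreg.2]
  · rw [card_filter_mul_inv_eq_pdsReps D hg]
    by_cases hgD : g ∈ D
    · simp [hl g hg hgD, hg, hgD]
    · simp [hm g hg hgD, hg, hgD]

open MonoidAlgebra in
lemma groupAlgebraSum_mul_univ {R : Type*} [CommRing R] (D : Finset G) :
    groupAlgebraSum R D * groupAlgebraSum R Finset.univ =
      D.card • groupAlgebraSum R Finset.univ := by
  rw [groupAlgebraSum, Finset.sum_mul, ← Finset.sum_const]
  refine Finset.sum_congr rfl fun d _ => ?_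
  simp only [groupAlgebraSum, Finset.mul_sum, ← map_mul]
  exact Fintype.sum_equiv (Equiv.mulLeft d) _ _ fun _ => rfl

open MonoidAlgebra in
lemma groupAlgebraSum_add_two_pow (q : ℕ) [Fact q.Prime] (n : ℕ) (D : Finset G) :
    (groupAlgebraSum (ZMod q) D + 2) ^ q ^ n = ∑ d ∈ D, of (ZMod q) G (d ^ q ^ n) + 2 := by
  have : CharP (MonoidAlgebra (ZMod q) G) q :=
    charP_of_injective_algebraMap (FaithfulSMul.algebraMap_injective (ZMod q) _) q
  have h2 : (2 : MonoidAlgebra (ZMod q) G) ^ q ^ n = 2 := by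
    have := congrArg (algebraMap (ZMod q) (MonoidAlgebra (ZMod q) G))
      (ZMod.pow_card_pow (n := n) (2 : ZMod q))
    simpa only [map_pow, map_ofNat] using this
  rw [add_pow_char_pow, h2, groupAlgebraSum, sum_pow_char_pow]
  simp only [map_pow]

/-- For these parameters the nonprincipal character values of `D + 2` are `± 2 * p`. -/
lemma sq_groupAlgebraSum_add_two {R : Type*} [CommRing R] {p : ℕ} (hp : 1 ≤ p) {D : Finset G}
    (h : IsPDS D (8 * p ^ 3) (4 * p ^ 2 + 2 * p - 2) (2 * p - 2) (2 * p + 2))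
    (hreg : IsRegularPDS D) :
    (groupAlgebraSum R D + 2) ^ 2 =
      (2 * p : MonoidAlgebra R G) ^ 2 + (2 * p + 2 : MonoidAlgebra R G) * groupAlgebraSum R Finset.univ := by
  have h1 := h.groupAlgebraSum_mul_self (R := R) hreg
  simp only [nsmul_eq_mul] at h1
  rw [Nat.cast_sub (by nlinarith), Nat.cast_sub (by omega)] at h1
  push_cast at h1
  linear_combination h1

lemma groupAlgebraSum_add_two_mul_univ {R : Type*} [CommRing R] {p : ℕ} (hp : 1 ≤ p) {D : Finset G}
    (h : D.card = 4 * p ^ 2 + 2 * p - 2) :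
    (groupAlgebraSum R D + 2) * groupAlgebraSum R Finset.univ =
      ((4 * p ^ 2 + 2 * p : ℕ) : MonoidAlgebra R G) * groupAlgebraSum R Finset.univ := by
  have : 4 * p ^ 2 + 2 * p = D.card + 2 := by
    have : 2 ≤ 4 * p ^ 2 + 2 * p := by nlinarith
    omega
  rw [add_mul, groupAlgebraSum_mul_univ, this, nsmul_eq_mul]
  push_cast
  ring

/-- For these parameters the nonprincipal character values of `D + 2` are `± 2 * p`. -/
lemma pow_three_groupAlgebraSum_add_two {R : Type*} [CommRing R] {p : ℕ} (hp : 1 ≤ p)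
    {D : Finset G}
    (h : IsPDS D (8 * p ^ 3) (4 * p ^ 2 + 2 * p - 2) (2 * p - 2) (2 * p + 2))
    (hreg : IsRegularPDS D) :
    (groupAlgebraSum R D + 2) ^ 3 =
      (2 * p : MonoidAlgebra R G) ^ 2 * (groupAlgebraSum R D + 2) +
        (((2 * p + 2) * (4 * p ^ 2 + 2 * p) : ℕ) : MonoidAlgebra R G) *
          groupAlgebraSum R Finset.univ := by
  have h1 := sq_groupAlgebraSum_add_two (R := R) hp h hreg
  have h2 := groupAlgebraSum_add_two_mul_univ (R := R) hp h.2.1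
  push_cast at h2 ⊢
  linear_combination (groupAlgebraSum R D + 2) * h1 + (2 * p + 2 : MonoidAlgebra R G) * h2

lemma exists_groupAlgebraSum_add_two_pow_odd (R : Type*) [CommRing R] {p : ℕ} (hp : 1 ≤ p)
    {D : Finset G}
    (h : IsPDS D (8 * p ^ 3) (4 * p ^ 2 + 2 * p - 2) (2 * p - 2) (2 * p + 2))
    (hreg : IsRegularPDS D) (n : ℕ) :
    ∃ c : ℕ, (groupAlgebraSum R D + 2) ^ (2 * n + 1) =
      (2 * p : MonoidAlgebra R G) ^ (2 * n) * (groupAlgebraSum R D + 2) +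
        (c : MonoidAlgebra R G) * groupAlgebraSum R Finset.univ := by
  induction n with
  | zero => exact ⟨0, by simp⟩
  | succ n ih =>
    obtain ⟨c, hc⟩ := ih
    have h2 := groupAlgebraSum_add_two_mul_univ (R := R) hp h.2.1
    have h3 := pow_three_groupAlgebraSum_add_two (R := R) hp h hreg
    refine ⟨(2 * p) ^ (2 * n) * ((2 * p + 2) * (4 * p ^ 2 + 2 * p)) +
      c * (4 * p ^ 2 + 2 * p) ^ 2, ?_⟩
    push_cast at h2 h3 ⊢
    linear_combination (groupAlgebraSum R D + 2) ^ 2 * hc +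
      (2 * p : MonoidAlgebra R G) ^ (2 * n) * h3 +
      c * (groupAlgebraSum R D + 2 + (4 * p ^ 2 + 2 * p)) * h2

lemma pow_prime_mem {p : ℕ} (hp : 1 ≤ p) {D : Finset G}
    (h : IsPDS D (8 * p ^ 3) (4 * p ^ 2 + 2 * p - 2) (2 * p - 2) (2 * p + 2))
    (hreg : IsRegularPDS D) {q : ℕ} (hq : q.Prime) (hqp : q.Coprime (8 * p)) {d : G}
    (hd : d ∈ D) : d ^ q ∈ D := by
  have : Fact q.Prime := ⟨hq⟩
  have hq2 : q ≠ 2 := by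
    rintro rfl
    exact absurd (Nat.coprime_mul_iff_right.1 hqp).1 (by decide)
  obtain ⟨n, hn⟩ := hq.odd_of_ne_two hq2
  have hcard : (Nat.card G).Coprime q := by
    rw [Nat.card_eq_fintype_card, h.1]
    have h8 := (Nat.coprime_mul_iff_right.1 hqp).1
    have hp' := (Nat.coprime_mul_iff_right.1 hqp).2
    exact (Nat.Coprime.mul_right h8 (hp'.pow_right 3)).symm
  have hinj : Function.Injective fun x : G => x ^ q := (powCoprime hcard).injective
  have hone : ∀ x ∈ D, x ^ q ≠ 1 := fun x hx h1 =>
    hreg.2 (hinj (a₁ := x) (a₂ := 1) (by simpa using h1) ▸ hx)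
  have hunit : (2 * p : MonoidAlgebra (ZMod q) G) ^ (2 * n) = 1 := by
    have h2p : ((2 * p : ℕ) : ZMod q) ≠ 0 := by
      rw [Ne, ZMod.natCast_eq_zero_iff]
      intro hdvd
      exact hq.one_lt.ne' (Nat.Coprime.eq_one_of_dvd hqp
        (hdvd.trans ⟨4, by ring⟩))
    have h1 := ZMod.pow_card_sub_one_eq_one h2p
    rw [show q - 1 = 2 * n by omega] at h1
    have := congrArg (algebraMap (ZMod q) (MonoidAlgebra (ZMod q) G)) h1
    simpa only [map_pow, map_mul, map_natCast, map_ofNat, map_one, Nat.cast_mul, Nat.cast_ofNat]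
      using this
  obtain ⟨c, hc⟩ := exists_groupAlgebraSum_add_two_pow_odd (ZMod q) hp h hreg n
  have hfrob := groupAlgebraSum_add_two_pow q 1 D
  rw [pow_one, (congrArg (fun m => (groupAlgebraSum (ZMod q) D + 2) ^ m) hn).trans hc, hunit, one_mul] at hfrob
  have hcoeff : ∀ g : G, ((if g ∈ D then 1 else 0) + (c : ZMod q)) =
      (D.filter fun x => x ^ q = g).card := by
    intro g
    have h1 := congrArg (fun x => x.coeff g) (add_right_cancel (b := 2)
      (show groupAlgebraSum (ZMod q) D +
          (c : MonoidAlgebra (ZMod q) G) * groupAlgebraSum (ZMod q) Finset.univ + 2 = _ by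
        rw [← hfrob]; ring))
    simpa only [MonoidAlgebra.coeff_add, Finsupp.add_apply, coeff_sum_of, coeff_groupAlgebraSum,
      ← nsmul_eq_mul, MonoidAlgebra.coeff_smul, Finsupp.smul_apply, Finset.mem_univ, if_true,
      nsmul_one] using h1
  have hc0 : (c : ZMod q) = 0 := by
    have h1 := hcoeff 1
    rw [Finset.filter_false_of_mem hone] at h1
    simpa [hreg.2] using h1
  by_contra hdq
  have h1 := hcoeff (d ^ q)
  have h2 : (D.filter fun x => x ^ q = d ^ q) = {d} := by
    ext x
    simp only [Finset.mem_filter, Finset.mem_singleton]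
    exact ⟨fun hx => hinj hx.2, fun hx => by simp [hx, hd]⟩
  simp [h2, hdq, hc0] at h1

lemma pow_mem_of_coprime {p : ℕ} (hp : 1 ≤ p) {D : Finset G}
    (h : IsPDS D (8 * p ^ 3) (4 * p ^ 2 + 2 * p - 2) (2 * p - 2) (2 * p + 2))
    (hreg : IsRegularPDS D) (s : ℕ) :
    s.Coprime (8 * p) → ∀ d ∈ D, d ^ s ∈ D := by
  induction s using induction_on_primes with
  | zero =>
    intro hs
    rw [Nat.coprime_zero_left] at hs
    omega
  | one => simp
  | prime_mul q s hq ih =>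
    intro hs d hd
    rw [pow_mul]
    exact ih (Nat.coprime_mul_iff_left.1 hs).2 _ (pow_prime_mem hp h hreg hq (Nat.coprime_mul_iff_left.1 hs).1 hd)

lemma dvd_card_filter_pow_eq {p : ℕ} (hp : p.Prime) {D : Finset G}
    (h : IsPDS D (8 * p ^ 3) (4 * p ^ 2 + 2 * p - 2) (2 * p - 2) (2 * p + 2))
    (hreg : IsRegularPDS D) (g : G) :
    p ∣ (D.filter fun x => x ^ p ^ 4 = g).card + if g = 1 then 2 else 0 := by
  have : Fact p.Prime := ⟨hp⟩
  have hfrob := groupAlgebraSum_add_two_pow p 4 D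
  have hp0 : (p : MonoidAlgebra (ZMod p) G) = 0 := by
    have := congrArg (algebraMap (ZMod p) (MonoidAlgebra (ZMod p) G)) (ZMod.natCast_self p)
    simpa only [map_natCast, map_zero] using this
  have h3 : (groupAlgebraSum (ZMod p) D + 2) ^ 3 = 0 := by
    rw [pow_three_groupAlgebraSum_add_two hp.one_le h hreg]
    push_cast
    rw [hp0]
    ring
  have hle : 3 ≤ p ^ 4 := by
    have := Nat.pow_le_pow_left hp.two_le 4
    omega
  rw [pow_eq_zero_of_le hle h3] at hfrob
  have h1 := congrArg (fun x => x.coeff g) hfrob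
  have h2 := coeff_natCast_monoidAlgebra (R := ZMod p) 2 g
  rw [← ZMod.natCast_eq_zero_iff]
  simp only [MonoidAlgebra.coeff_add, Finsupp.add_apply, coeff_sum_of] at h1
  push_cast at h2 ⊢
  rw [h2] at h1
  simpa using h1.symm

open scoped Classical in
/-- The nontrivial elements of a coset of the `p`-part, lying in a set closed under suitable
powers, split into classes whose sizes are totients of nontrivial powers of `p`. -/
lemma sub_one_dvd_card_filter {p M n : ℕ} (hp : p.Prime) (hM : M.Coprime p) {D : Finset G}
    (hD : ∀ s : ℕ, s.Coprime (M * p) → ∀ d ∈ D, d ^ s ∈ D) {h : G} (hh : h ^ M = 1)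
    (hhn : h ^ p ^ n = h) :
    p - 1 ∣ (D.filter fun x => x ^ p ^ n = h ∧ x ≠ h).card := by
  rw [Finset.card_eq_sum_card_image fun x => Subgroup.zpowers (x * h⁻¹)]
  refine Finset.dvd_sum fun Z hZ => ?_
  obtain ⟨x₀, hx₀, rfl⟩ := Finset.mem_image.1 hZ
  obtain ⟨hx₀D, hx₀h, hx₀ne⟩ := Finset.mem_filter.1 hx₀
  obtain ⟨y, rfl⟩ : ∃ y, x₀ = h * y := ⟨h⁻¹ * x₀, by simp⟩
  have hy : y ^ p ^ n = 1 := by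
    rw [mul_pow, hhn] at hx₀h
    exact mul_eq_left.1 hx₀h
  have hyne : y ≠ 1 := fun h1 => hx₀ne (by simp [h1])
  have hsimp : ∀ z : G, h * z * h⁻¹ = z := fun z => by rw [mul_comm h, mul_inv_cancel_right]
  obtain ⟨j, -, hj⟩ := (Nat.dvd_prime_pow hp).1 (orderOf_dvd_of_pow_eq_one hy)
  have hj0 : j ≠ 0 := by
    rintro rfl
    exact hyne (orderOf_eq_one_iff.1 (by simpa using hj))
  have hfiber : ((D.filter fun x => x ^ p ^ n = h ∧ x ≠ h).filter fun x =>
      Subgroup.zpowers (x * h⁻¹) = Subgroup.zpowers (h * y * h⁻¹)) =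
      ((Finset.range (orderOf y)).filter fun i => (orderOf y).Coprime i).image
        fun i => h * y ^ i := by
    ext x
    simp only [Finset.mem_filter, Finset.mem_image, Finset.mem_range, hsimp]
    constructor
    · rintro ⟨-, hx⟩
      have hmem : x * h⁻¹ ∈ Subgroup.zpowers y := hx ▸ Subgroup.mem_zpowers _
      rw [mem_zpowers_iff_mem_range_orderOf, Finset.mem_image] at hmem
      obtain ⟨i, hi, hxi⟩ := hmem
      refine ⟨i, ⟨Finset.mem_range.1 hi, ?_⟩, by rw [hxi, mul_comm, inv_mul_cancel_right]⟩
      have hyi : y ∈ Subgroup.zpowers (y ^ i) := by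
        rw [hxi, hx]
        exact Subgroup.mem_zpowers y
      exact Nat.Coprime.symm (mem_zpowers_pow_iff.1 hyi)
    · rintro ⟨i, ⟨-, hi⟩, rfl⟩
      have hMj : M.Coprime (orderOf y) := hj ▸ hM.pow_right j
      obtain ⟨s, hs1, hsi⟩ := Nat.chineseRemainder hMj 1 i
      have hsM : s.Coprime M := by
        have := hs1.gcd_eq
        rw [Nat.gcd_one_left] at this
        exact this
      have hsp : s.Coprime p := by
        have h1 : s.Coprime (orderOf y) := by
          have := hsi.gcd_eq
          rw [Nat.gcd_comm i, hi] at this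
          exact this
        rw [hj] at h1
        exact (Nat.coprime_pow_right_iff (Nat.pos_of_ne_zero hj0) _ _).1 h1
      have hhs : h ^ s = h := by
        conv_rhs => rw [← pow_one h]
        exact pow_eq_pow_iff_modEq.2 (hs1.of_dvd (orderOf_dvd_of_pow_eq_one hh))
      have hys : y ^ s = y ^ i := pow_eq_pow_iff_modEq.2 hsi
      have hyz : y ∈ Subgroup.zpowers (y ^ i) := mem_zpowers_pow_iff.2 hi.symm
      refine ⟨⟨?_, ?_, ?_⟩, ?_⟩
      · have := hD s (hsM.mul_right hsp) _ hx₀D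
        rwa [mul_pow, hhs, hys] at this
      · rw [mul_pow, hhn, ← pow_mul, mul_comm i, pow_mul, hy, one_pow, mul_one]
      · intro h1
        rw [mul_eq_left.1 h1] at hyz
        exact hyne (by simpa using hyz)
      · rw [hsimp]
        exact le_antisymm (by simp [Subgroup.zpowers_le, Subgroup.npow_mem_zpowers])
          (by simpa [Subgroup.zpowers_le] using hyz)
  rw [hfiber, Finset.card_image_of_injOn, ← Nat.totient_eq_card_coprime, hj,
    Nat.totient_prime_pow hp (Nat.pos_of_ne_zero hj0)]
  · exact dvd_mul_left _ _
  · intro a ha b hb hab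
    simp only [Finset.coe_filter, Finset.mem_range, Set.mem_ofPred_eq] at ha hb
    exact pow_injOn_Iio_orderOf ha.1 hb.1 (mul_left_cancel hab)

/-- Splitting a group of order `8 * p ^ 3` into its `2`-part, the range of the `p ^ 4`-th power
map, and its `p`-part, the kernel of that map. -/
lemma card_pow_eq_of_card {p : ℕ} (hp : p.Prime) (hp2 : p ≠ 2)
    (hG : Fintype.card G = 8 * p ^ 3) :
    (∀ x : G, (x ^ p ^ 4) ^ p ^ 4 = x ^ p ^ 4) ∧
      (Finset.univ.filter fun x : G => x ^ p ^ 4 = x).card = 8 ∧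
      (Finset.univ.filter fun x : G => x ^ p ^ 4 = 1).card = p ^ 3 := by
  have hodd : Odd p := hp.odd_of_ne_two hp2
  have : Fact p.Prime := ⟨hp⟩
  have : Fact (Nat.Prime 2) := ⟨Nat.prime_two⟩
  have hmod : (p ^ 4) * (p ^ 4) ≡ p ^ 4 [MOD (8 * p ^ 3)] := by
    have h8 : p ^ 4 ≡ 1 [MOD 8] := by
      have hlt : p % 8 < 8 := Nat.mod_lt _ (by norm_num)
      have h2 : p % 8 % 2 = 1 := by
        rw [Nat.mod_mod_of_dvd _ (by norm_num)]
        exact Nat.odd_iff.1 hodd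
      unfold Nat.ModEq
      rw [Nat.pow_mod]
      generalize p % 8 = r at hlt h2
      interval_cases r <;> simp_all
    convert (h8.mul_left' (p ^ 3)).mul_left p using 1 <;> ring
  let f : G →* G := powMonoidHom (p ^ 4)
  have hidem : ∀ x : G, (x ^ p ^ 4) ^ p ^ 4 = x ^ p ^ 4 := fun x => by
    rw [← pow_mul]
    exact pow_eq_pow_iff_modEq.2 (hmod.of_dvd (hG ▸ orderOf_dvd_card))
  have hprod : Nat.card f.ker * Nat.card f.range = 8 * p ^ 3 := by
    rw [← hG, ← Nat.card_eq_fintype_card, ← Subgroup.index_ker, Subgroup.card_mul_index]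
  obtain ⟨a, ha⟩ := IsPGroup.iff_card.1 (show IsPGroup p f.ker from fun x =>
    ⟨4, Subtype.ext x.2⟩)
  obtain ⟨b, hb⟩ := IsPGroup.iff_card.1 (show IsPGroup 2 f.range from by
    rintro ⟨_, x, rfl⟩
    refine ⟨3, Subtype.ext ?_⟩
    show (x ^ p ^ 4) ^ 2 ^ 3 = 1
    rw [← pow_mul]
    refine orderOf_dvd_iff_pow_eq_one.1 ((hG ▸ orderOf_dvd_card).trans ⟨p, by ring⟩))
  have hcop : Nat.Coprime 2 p := hodd.coprime_two_left
  rw [ha, hb] at hprod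
  have h8 : (2 : ℕ) ^ b = 8 := by
    apply Nat.dvd_antisymm
    · exact (Nat.Coprime.pow b 3 hcop).dvd_of_dvd_mul_right (hprod ▸ dvd_mul_left _ _)
    · have : Nat.Coprime (2 ^ 3) (p ^ a) := Nat.Coprime.pow 3 a hcop
      exact this.dvd_of_dvd_mul_left (hprod ▸ dvd_mul_right _ _)
  have h3 : p ^ a = p ^ 3 := by
    rw [h8] at hprod
    omega
  refine ⟨hidem, ?_, ?_⟩
  · rw [← h8, ← hb, ← Nat.subtype_card (p := fun x => x ∈ f.range)]
    intro x
    simp only [Finset.mem_filter, Finset.mem_univ, true_and]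
    exact ⟨fun hx => ⟨x, hx⟩, by rintro ⟨y, rfl⟩; exact hidem y⟩
  · rw [← h3, ← ha, ← Nat.subtype_card (p := fun x => x ∈ f.ker)]
    intro x
    simp [f, MonoidHom.mem_ker]

lemma IsPDS.sum_sq_card_fiber {D : Finset G} {v k l m : ℕ} (h : IsPDS D v k l m)
    (hreg : IsRegularPDS D) (f : G →* G) {t : Finset G} (ht : ∀ x ∈ D, f x ∈ t) :
    ∑ g ∈ t, (D.filter fun x => f x = g).card ^ 2 +
        m * ((D.filter fun x => f x = 1).card + 1) =
      k + l * (D.filter fun x => f x = 1).card +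
        m * (Finset.univ.filter fun x => f x = 1).card := by
  obtain ⟨-, hk, hl, hm⟩ := h
  have h1 : ∑ g ∈ t, (D.filter fun x => f x = g).card ^ 2 =
      ((D ×ˢ D).filter fun x => f x.1 = f x.2).card := by
    rw [Finset.card_eq_sum_card_fiberwise (f := fun x => f x.1) (t := t)]
    · refine Finset.sum_congr rfl fun g _ => ?_
      rw [sq, ← Finset.card_product]
      congr 1
      ext x
      simp only [Finset.mem_product, Finset.mem_filter]
      grind
    · intro x hx
      simp only [Finset.coe_filter, Finset.mem_product, Set.mem_ofPred_eq] at hx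
      exact ht _ hx.1.1
  have h2 : ((D ×ˢ D).filter fun x => f x.1 = f x.2).card =
      ∑ g ∈ Finset.univ.filter (fun x => f x = 1),
        ((D ×ˢ D).filter fun x => x.1 * x.2⁻¹ = g).card := by
    rw [Finset.card_eq_sum_card_fiberwise (f := fun x => x.1 * x.2⁻¹)
      (t := Finset.univ.filter fun x => f x = 1)]
    · refine Finset.sum_congr rfl fun g hg => ?_
      rw [Finset.filter_filter]
      congr 1
      refine Finset.filter_congr fun x _ => ⟨fun hx => hx.2, fun hx => ⟨?_, hx⟩⟩
      have hfg := (Finset.mem_filter.1 hg).2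
      rw [← hx, map_mul, map_inv, mul_inv_eq_one] at hfg
      exact hfg
    · intro x hx
      simp only [Finset.coe_filter, Set.mem_ofPred_eq] at hx
      simp [hx.2]
  have h3 : ∀ g : G, ((D ×ˢ D).filter fun x => x.1 * x.2⁻¹ = g).card +
      ((if g ∈ D then m else 0) + if g = 1 then m else 0) =
      (if g = 1 then k else 0) + (if g ∈ D then l else 0) + m := by
    intro g
    by_cases hg : g = 1
    · subst hg
      simp [card_filter_mul_inv_eq_one, hk, hreg.2]
    · rw [card_filter_mul_inv_eq_pdsReps D hg]
      by_cases hgD : g ∈ D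
      · simp [hl g hg hgD, hg, hgD, add_comm]
      · simp [hm g hg hgD, hg, hgD]
  have h4 := Finset.sum_congr (rfl : Finset.univ.filter (fun x => f x = 1) = _) fun g _ => h3 g
  have h5 : (Finset.univ.filter fun x => f x = 1).filter (· ∈ D) =
      D.filter fun x => f x = 1 := by
    ext x
    simp [and_comm]
  have h6 : ((Finset.univ.filter fun x => f x = 1).filter (· = 1)).card = 1 := by
    rw [Finset.card_eq_one]
    refine ⟨1, ?_⟩
    ext x
    simp only [Finset.mem_filter, Finset.mem_univ, true_and, Finset.mem_singleton]
    exact ⟨fun hx => hx.2, fun hx => by simp [hx]⟩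
  simp only [Finset.sum_add_distrib, ← Finset.sum_filter, Finset.sum_const, h5, h6,
    smul_eq_mul] at h4
  rw [h1, h2]
  linarith

lemma false_of_sum_eq_of_sum_sq_eq {ι : Type*} {s : Finset ι} (hs : s.card = 8) {e : ι}
    (hes : e ∈ s) {c : ι → ℤ} {p : ℤ} (hp5 : 5 ≤ p) (hp6 : p ≠ 6)
    (hsum : ∑ i ∈ s, c i = 4 * p + 2) (hsq : ∑ i ∈ s, c i ^ 2 = 2 * p ^ 2 + 2 * p + 4)
    (he : p - 1 ∣ c e - 2) (hc : ∀ i ∈ s, i ≠ e → p - 1 ∣ c i ∨ p - 1 ∣ c i - 1) : False := by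
  classical
  have hdev : ∑ i ∈ s, (4 * c i - (2 * p + 1)) ^ 2 = 56 := by
    have : ∀ i, (4 * c i - (2 * p + 1)) ^ 2 =
        16 * c i ^ 2 - 8 * (2 * p + 1) * c i + (2 * p + 1) ^ 2 := fun i => by ring
    simp only [this, Finset.sum_add_distrib, Finset.sum_sub_distrib, ← Finset.mul_sum, hsum, hsq,
      Finset.sum_const, hs, nsmul_eq_mul]
    push_cast
    ring
  have hbound : ∀ i ∈ s, 2 * p - 6 ≤ 4 * c i ∧ 4 * c i ≤ 2 * p + 8 := by
    intro i hi
    have h1 := Finset.single_le_sum (f := fun i => (4 * c i - (2 * p + 1)) ^ 2)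
      (fun i _ => sq_nonneg _) hi
    rw [hdev] at h1
    have h2 : |4 * c i - (2 * p + 1)| < 8 := abs_lt_of_sq_lt_sq (by linarith) (by norm_num)
    rw [abs_lt] at h2
    constructor <;> omega
  have hp : p = 5 := by
    by_contra hne
    have hp7 : 7 ≤ p := by omega
    obtain ⟨i, hi, hie⟩ := Finset.exists_mem_ne (s := s) (by omega) e
    obtain ⟨hl, hu⟩ := hbound i hi
    rcases hc i hi hie with ⟨t, ht⟩ | ⟨t, ht⟩
    · rcases le_or_gt t 0 with h0 | h0 <;> nlinarith
    · rcases le_or_gt t 0 with h0 | h0 <;> nlinarith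
  subst hp
  have hmod : ∀ i ∈ s, c i ≡ (if i = e then 2 else 1) [ZMOD 3] := by
    intro i hi
    obtain ⟨hl, hu⟩ := hbound i hi
    unfold Int.ModEq
    split_ifs with hie
    · subst hie
      omega
    · have := hc i hi hie
      omega
  have h1 : ∑ i ∈ s, c i ≡ ∑ i ∈ s, (if i = e then 2 else 1) [ZMOD 3] := by
    rw [Int.modEq_iff_dvd, ← Finset.sum_sub_distrib]
    exact Finset.dvd_sum fun i hi => (hmod i hi).dvd
  have h2 : ∑ i ∈ s, (if i = e then (2 : ℤ) else 1) = 9 := by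
    have : ∀ i, (if i = e then (2 : ℤ) else 1) = 1 + if i = e then 1 else 0 := fun i => by
      split_ifs <;> rfl
    simp [this, Finset.sum_add_distrib, hs, hes]
  rw [hsum, h2] at h1
  exact absurd h1 (by decide)

/-- There is no regular `(8p^3, 4p^2+2p-2, 2p-2, 2p+2)`-PDS in an Abelian group,
for `p ≥ 5` prime. -/
theorem no_pds_case1 (p : ℕ) (hp : p.Prime) (hp5 : 5 ≤ p)
    {G : Type*} [CommGroup G] [DecidableEq G] [Fintype G]
    (D : Finset G) :
    ¬ (IsPDS D (8 * p ^ 3) (4 * p ^ 2 + 2 * p - 2) (2 * p - 2) (2 * p + 2) ∧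
        IsRegularPDS D) := by
  rintro ⟨h, hreg⟩
  have hG := h.1
  have hp2 : p ≠ 2 := by omega
  have hp6 : p ≠ 6 := by
    rintro rfl
    exact absurd hp (by decide)
  have h8p : Nat.Coprime 8 p :=
    Nat.Coprime.pow_left 3 (hp.odd_of_ne_two hp2).coprime_two_left
  obtain ⟨hidem, hH, hP⟩ := card_pow_eq_of_card hp hp2 hG
  have hpow := pow_mem_of_coprime hp.one_le h hreg
  set H := Finset.univ.filter fun x : G => x ^ p ^ 4 = x
  have hmaps : ∀ x ∈ D, powMonoidHom (p ^ 4) x ∈ H := fun x _ => by simp [H, hidem]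
  have hsum := Finset.card_eq_sum_card_fiberwise hmaps
  have hsq := h.sum_sq_card_fiber hreg (powMonoidHom (p ^ 4)) hmaps
  simp only [powMonoidHom_apply, hP, h.2.1] at hsum hsq
  choose c hc using fun g => dvd_card_filter_pow_eq hp h hreg g
  set b : G → ℕ := fun g => (D.filter fun x => x ^ p ^ 4 = g).card
  have hbD : ∀ g ∈ H, ((p : ℤ) - 1) ∣ b g - if g ∈ D then 1 else 0 := by
    intro g hg
    have hgN : g ^ p ^ 4 = g := (Finset.mem_filter.1 hg).2
    have hg8 : g ^ 8 = 1 := by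
      rw [← hgN, ← pow_mul]
      exact orderOf_dvd_iff_pow_eq_one.1 ((hG ▸ orderOf_dvd_card).trans ⟨p, by ring⟩)
    have h1 := sub_one_dvd_card_filter hp h8p hpow hg8 hgN
    have h2 : b g = (D.filter fun x => x ^ p ^ 4 = g ∧ x ≠ g).card + if g ∈ D then 1 else 0 := by
      have h3 := Finset.card_filter_add_card_filter_not (s := D.filter fun x => x ^ p ^ 4 = g)
        (fun x => x ≠ g)
      have h4 : ((D.filter fun x => x ^ p ^ 4 = g).filter fun x => ¬ x ≠ g).card =
          if g ∈ D then 1 else 0 := by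
        split_ifs with hgD
        · rw [Finset.card_eq_one]
          refine ⟨g, ?_⟩
          ext x
          simp only [Finset.mem_filter, not_not, Finset.mem_singleton]
          exact ⟨fun hx => hx.2, by rintro rfl; exact ⟨⟨hgD, hgN⟩, rfl⟩⟩
        · rw [Finset.card_eq_zero, Finset.filter_eq_empty_iff]
          rintro x hx hxg
          rw [not_not] at hxg
          exact hgD (hxg ▸ (Finset.mem_filter.1 hx).1)
      rw [h4, Finset.filter_filter] at h3
      exact h3.symm
    rw [h2]
    push_cast
    rw [add_sub_cancel_right, ← Nat.cast_pred hp.pos]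
    exact_mod_cast h1
  have hcast : ∀ g, (p : ℤ) * c g = b g + if g = 1 then 2 else 0 := fun g => by
    have := hc g
    rw [← Nat.cast_mul, ← this]
    push_cast
    rfl
  have hcmod : ∀ g ∈ H, ((p : ℤ) - 1) ∣
      c g - ((if g ∈ D then 1 else 0) + if g = 1 then 2 else 0) := by
    intro g hg
    have h1 := dvd_sub (hbD g hg) (dvd_mul_right ((p : ℤ) - 1) (c g))
    have h2 : (c g : ℤ) - ((if g ∈ D then 1 else 0) + if g = 1 then 2 else 0) =
        b g - (if g ∈ D then 1 else 0) - (p - 1) * c g := by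
      linear_combination hcast g
    rwa [h2]
  have h1H : (1 : G) ∈ H := by simp [H]
  have hp0 : (p : ℤ) ≠ 0 := by exact_mod_cast hp.ne_zero
  refine false_of_sum_eq_of_sum_sq_eq (c := fun g => (c g : ℤ)) (p := p) hH h1H
    (by exact_mod_cast hp5) (by exact_mod_cast hp6) ?_ ?_ ?_ ?_
  · apply mul_left_cancel₀ hp0
    rw [Finset.mul_sum]
    simp only [hcast, Finset.sum_add_distrib, Finset.sum_ite_eq', h1H, if_true]
    have h1 : (4 * p ^ 2 + 2 * p : ℕ) = ∑ g ∈ H, b g + 2 := by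
      have : 2 ≤ 4 * p ^ 2 + 2 * p := by nlinarith
      have : 4 * p ^ 2 + 2 * p - 2 = ∑ g ∈ H, b g := hsum
      omega
    have h2 : (4 * p ^ 2 + 2 * p : ℤ) = ∑ g ∈ H, (b g : ℤ) + 2 := by exact_mod_cast h1
    linear_combination -h2
  · apply mul_left_cancel₀ (pow_ne_zero 2 hp0)
    rw [Finset.mul_sum]
    have h1 : ∀ g, (p : ℤ) ^ 2 * (c g : ℤ) ^ 2 =
        (b g : ℤ) ^ 2 + if g = 1 then 4 * (b 1 : ℤ) + 4 else 0 := fun g => by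
      rw [← mul_pow, hcast]
      split_ifs with hg
      · subst hg
        ring
      · ring
    simp only [h1, Finset.sum_add_distrib, Finset.sum_ite_eq', h1H, if_true]
    have h2 := congrArg (Nat.cast : ℕ → ℤ) hsq
    have h3 : 2 ≤ 4 * p ^ 2 + 2 * p := by nlinarith
    push_cast [Nat.cast_sub h3, Nat.cast_sub (show 2 ≤ 2 * p by omega)] at h2
    linear_combination h2
  · simpa [hreg.2] using hcmod 1 h1H
  · intro g hg hg1
    have := hcmod g hg
    by_cases hgD : g ∈ D
    · right
      simpa [hgD, hg1] using this
    · left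
      simpa [hgD, hg1] using this
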